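/- For every real α with 0 < α < 1, the derivative at s = 0 of the function s ↦ ζ_H(s, α) + ζ_H(s, 1−α) equals log(csc(πα)) − log 2, i.e. equals −log(2·sin(πα)). -/

import Mathlib

open Real

open Set Filter Topology MeasureTheory Asymptotics

/-- The closed form of `∑ n ≥ 1, cos (n * θ) * exp (-n * t)`, where `c = cos θ`. -/
noncomputable def cosGeomKernel (c t : ℝ) : ℝ :=
  rexp (-t) * (c - rexp (-t)) / (1 - 2 * c * rexp (-t) + rexp (-t) ^ 2)

lemma half_one_sub_le_quadratic {c x : ℝ} (hc : -1 ≤ c) :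
    (1 - c) / 2 * (1 + x) ^ 2 ≤ 1 - 2 * c * x + x ^ 2 := by
  nlinarith [mul_nonneg (by linarith : 0 ≤ 1 + c) (sq_nonneg (1 - x))]

lemma one_sub_two_mul_add_sq_pos {c x : ℝ} (hc : -1 ≤ c) (hc1 : c < 1) (hx : 0 ≤ x) :
    0 < 1 - 2 * c * x + x ^ 2 :=
  lt_of_lt_of_le (mul_pos (by linarith) (by positivity)) (half_one_sub_le_quadratic hc)

lemma continuous_cosGeomKernel {c : ℝ} (hc : -1 ≤ c) (hc1 : c < 1) :
    Continuous (cosGeomKernel c) := by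
  unfold cosGeomKernel
  exact Continuous.div (by fun_prop) (by fun_prop)
    fun t ↦ (one_sub_two_mul_add_sq_pos hc hc1 (exp_pos _).le).ne'

lemma abs_cosGeomKernel_le {c t : ℝ} (hc : -1 ≤ c) (hc1 : c < 1) (ht : 0 ≤ t) :
    |cosGeomKernel c t| ≤ 4 / (1 - c) * rexp (-t) := by
  have hx : 0 < rexp (-t) := exp_pos _
  have hx1 : rexp (-t) ≤ 1 := exp_le_one_iff.mpr (by linarith)
  unfold cosGeomKernel
  generalize rexp (-t) = x at *
  have hD := one_sub_two_mul_add_sq_pos hc hc1 hx.le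
  have hle := half_one_sub_le_quadratic (x := x) hc
  have h1c : 0 < 1 - c := by linarith
  have hD' : (1 - c) / 2 ≤ 1 - 2 * c * x + x ^ 2 := by nlinarith
  have habs : |c - x| ≤ 2 := abs_le.mpr ⟨by linarith, by linarith⟩
  rw [abs_div, abs_mul, abs_of_pos hx, abs_of_pos hD, div_le_iff₀ hD]
  calc x * |c - x| ≤ x * 2 := by gcongr
    _ = 4 / (1 - c) * x * ((1 - c) / 2) := by field_simp; ring
    _ ≤ _ := by gcongr

lemma hasSum_cosGeomKernel (θ : ℝ) {t : ℝ} (ht : 0 < t) :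
    HasSum (fun n : ℕ ↦ Real.cos (θ * (n + 1 : ℕ)) * rexp (-(n + 1 : ℕ) * t))
      (cosGeomKernel (Real.cos θ) t) := by
  set w : ℂ := Complex.exp (θ * Complex.I - t) with hw
  have hnorm : ‖w‖ < 1 := by simp [hw, Complex.norm_exp, ht]
  have hre : w.re = rexp (-t) * Real.cos θ := by simp [hw, Complex.exp_re]
  have him : w.im = rexp (-t) * Real.sin θ := by simp [hw, Complex.exp_im]
  have key := Complex.hasSum_re ((hasSum_geometric_of_norm_lt_one hnorm).mul_left w)
  convert! key using 1
  · ext n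
    rw [← pow_succ', hw, ← Complex.exp_nat_mul, Complex.exp_re]
    simp
    ring_nf
  · have hs := Real.sin_sq_add_cos_sq θ
    have hns : Complex.normSq (1 - w) =
        1 - 2 * Real.cos θ * rexp (-t) + rexp (-t) ^ 2 := by
      rw [Complex.normSq_apply]
      simp only [Complex.sub_re, Complex.sub_im, Complex.one_re, Complex.one_im, hre, him]
      linear_combination rexp (-t) ^ 2 * hs
    rw [← div_eq_mul_inv, Complex.div_re, hns, ← add_div, cosGeomKernel]
    congr 1
    simp only [Complex.sub_re, Complex.sub_im, Complex.one_re, Complex.one_im, hre, him]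
    linear_combination rexp (-t) ^ 2 * hs

lemma integrableOn_cosGeomKernel {c : ℝ} (hc : -1 ≤ c) (hc1 : c < 1) :
    IntegrableOn (cosGeomKernel c) (Ioi 0) := by
  refine Integrable.mono' ((integrableOn_exp_neg_Ioi 0).const_mul (4 / (1 - c)))
    (continuous_cosGeomKernel hc hc1).aestronglyMeasurable ?_
  filter_upwards [ae_restrict_mem measurableSet_Ioi] with t ht
  exact abs_cosGeomKernel_le hc hc1 (mem_Ioi.mp ht).le

lemma integral_cosGeomKernel {c : ℝ} (hc : -1 ≤ c) (hc1 : c < 1) :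
    ∫ t in Ioi 0, cosGeomKernel c t = -(Real.log (2 - 2 * c) / 2) := by
  have hderiv : ∀ t ∈ Ici (0 : ℝ), HasDerivAt
      (fun t ↦ Real.log (1 - 2 * c * rexp (-t) + rexp (-t) ^ 2) / 2) (cosGeomKernel c t) t := by
    intro t _
    have hx : HasDerivAt (fun t ↦ rexp (-t)) (-rexp (-t)) t := by
      simpa using (hasDerivAt_neg t).exp
    have hD := (one_sub_two_mul_add_sq_pos hc hc1 (exp_pos (-t)).le).ne'
    convert! ((((hx.const_mul (2 * c)).const_sub 1).add (hx.pow 2)).log hD).div_const 2 using 1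
    rw [cosGeomKernel]
    simp only [Pi.add_apply, Pi.pow_apply]
    field_simp
    push_cast
    ring
  have htop : Tendsto (fun t ↦ Real.log (1 - 2 * c * rexp (-t) + rexp (-t) ^ 2) / 2)
      atTop (𝓝 0) := by
    have hx : Tendsto (fun t : ℝ ↦ rexp (-t)) atTop (𝓝 0) := tendsto_exp_neg_atTop_nhds_zero
    have h1 : Tendsto (fun t ↦ 1 - 2 * c * rexp (-t) + rexp (-t) ^ 2) atTop (𝓝 1) := by
      simpa using ((hx.const_mul (2 * c)).const_sub 1).add (hx.pow 2)
    simpa using (h1.log one_ne_zero).div_const 2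
  rw [integral_Ioi_of_hasDerivAt_of_tendsto' hderiv (integrableOn_cosGeomKernel hc hc1) htop]
  simp
  ring_nf

lemma differentiableAt_mellin_cosGeomKernel {c : ℝ} (hc : -1 ≤ c) (hc1 : c < 1) {s : ℂ}
    (hs : 0 < s.re) : DifferentiableAt ℂ (mellin fun t ↦ (cosGeomKernel c t : ℂ)) s := by
  have hcont : Continuous fun t ↦ (cosGeomKernel c t : ℂ) :=
    Complex.continuous_ofReal.comp (continuous_cosGeomKernel hc hc1)
  refine mellin_differentiableAt_of_isBigO_rpow_exp (a := 1) (b := 0) one_pos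
    (hcont.locallyIntegrable.locallyIntegrableOn _) ?_ ?_ hs
  · refine IsBigO.of_bound (4 / (1 - c)) ?_
    filter_upwards [eventually_ge_atTop 0] with t ht
    simpa using abs_cosGeomKernel_le hc hc1 ht
  · simpa using (hcont.tendsto 0).isBigO_one ℝ |>.mono nhdsWithin_le_nhds

lemma mellin_cosGeomKernel (a : ℝ) {s : ℂ} (hs : 1 < s.re) :
    mellin (fun t ↦ (cosGeomKernel (Real.cos (2 * π * a)) t : ℂ)) s =
      Complex.Gamma s * HurwitzZeta.cosZeta a s := by
  have hmellin := hasSum_mellin (ι := ℕ)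
    (a := fun n ↦ (Real.cos (2 * π * a * (n + 1 : ℕ)) : ℂ)) (p := fun n ↦ ((n + 1 : ℕ) : ℝ))
    (F := fun t ↦ (cosGeomKernel (Real.cos (2 * π * a)) t : ℂ)) (s := s)
    (fun n ↦ Or.inr (by positivity)) (by linarith)
    (fun t ht ↦ by
      exact_mod_cast Complex.hasSum_ofReal.mpr (hasSum_cosGeomKernel (2 * π * a) ht))
    (by
      refine Summable.of_nonneg_of_le (fun n ↦ by positivity) (fun n ↦ ?_)
        ((summable_nat_add_iff 1).mpr (Real.summable_one_div_nat_rpow.mpr hs))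
      gcongr
      rw [Complex.norm_real]
      exact abs_cos_le_one _)
  have hz := (hasSum_nat_add_iff' 1).mpr (HurwitzZeta.hasSum_nat_cosZeta a hs)
  have hs0 : s ≠ 0 := by rintro rfl; norm_num at hs
  simp only [Finset.range_one, Finset.sum_singleton, Nat.cast_zero, Complex.zero_cpow hs0,
    div_zero, sub_zero] at hz
  refine hmellin.unique ?_
  convert! hz.mul_left (Complex.Gamma s) using 2 with n
  push_cast
  ring

lemma unitAddCircle_coe_ne_zero {a : ℝ} (h0 : 0 < a) (h1 : a < 1) :
    (a : UnitAddCircle) ≠ 0 := by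
  rw [Ne, AddCircle.coe_eq_zero_iff_of_mem_Ico (by simp [h0.le, h1])]
  exact h0.ne'

lemma cosZeta_one {a : ℝ} (h0 : 0 < a) (h1 : a < 1) :
    HurwitzZeta.cosZeta a 1 = -(Real.log (2 * Real.sin (π * a)) : ℂ) := by
  have hsin : 0 < Real.sin (π * a) :=
    sin_pos_of_pos_of_lt_pi (by positivity) (by nlinarith [pi_pos])
  have hcos : Real.cos (2 * π * a) = 1 - 2 * Real.sin (π * a) ^ 2 := by
    rw [mul_assoc, Real.cos_two_mul, Real.cos_sq']; ring
  have hc : -1 ≤ Real.cos (2 * π * a) := neg_one_le_cos _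
  have hc1 : Real.cos (2 * π * a) < 1 := by rw [hcos]; nlinarith [sq_pos_of_pos hsin]
  have ha := unitAddCircle_coe_ne_zero h0 h1
  have hL : ContinuousAt (fun r : ℝ ↦
      mellin (fun t ↦ (cosGeomKernel (Real.cos (2 * π * a)) t : ℂ)) r) 1 :=
    ContinuousAt.comp (f := fun r : ℝ ↦ (r : ℂ))
      (differentiableAt_mellin_cosGeomKernel hc hc1 (by simp)).continuousAt
      Complex.continuous_ofReal.continuousAt
  have hR : ContinuousAt (fun r : ℝ ↦ Complex.Gamma r * HurwitzZeta.cosZeta a r) 1 := by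
    refine ContinuousAt.comp (f := fun r : ℝ ↦ (r : ℂ))
      (g := fun s ↦ Complex.Gamma s * HurwitzZeta.cosZeta a s) ?_
      Complex.continuous_ofReal.continuousAt
    refine (DifferentiableAt.mul ?_
      (HurwitzZeta.differentiable_cosZeta_of_ne_zero ha _)).continuousAt
    simpa using Complex.differentiableAt_Gamma_one
  have heq := tendsto_nhds_unique_of_eventuallyEq
    (hL.tendsto.mono_left (nhdsWithin_le_nhds (s := Ioi 1)))
    (hR.tendsto.mono_left nhdsWithin_le_nhds)
    (by
      filter_upwards [self_mem_nhdsWithin] with r hr using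
        mellin_cosGeomKernel a (by simpa using hr))
  simp only [Complex.ofReal_one, Complex.Gamma_one, one_mul] at heq
  rw [← heq, mellin]
  simp only [sub_self, Complex.cpow_zero, one_smul]
  rw [integral_complex_ofReal, integral_cosGeomKernel hc hc1, hcos,
    show 2 - 2 * (1 - 2 * Real.sin (π * a) ^ 2) = (2 * Real.sin (π * a)) ^ 2 by ring,
    Real.log_pow]
  push_cast
  ring

lemma hasDerivAt_hurwitzZetaEven_zero {a : UnitAddCircle} (ha : a ≠ 0) :
    HasDerivAt (HurwitzZeta.hurwitzZetaEven a) (HurwitzZeta.cosZeta a 1 / 2) 0 := by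
  have hπ : (π : ℂ) ≠ 0 := by exact_mod_cast pi_ne_zero
  have hfactor : DifferentiableAt ℂ (fun s : ℂ ↦ 2 * (2 * π : ℂ) ^ (-s) * Complex.Gamma s) 1 := by
    refine DifferentiableAt.mul ?_ Complex.differentiableAt_Gamma_one
    exact (differentiableAt_id.neg.const_cpow (Or.inl (by simp [hπ]))).const_mul 2
  have hcos : HasDerivAt (fun s : ℂ ↦ Complex.cos (π * s / 2)) (-(π / 2)) 1 := by
    have := (((hasDerivAt_id (1 : ℂ)).const_mul (π : ℂ)).div_const 2).ccos
    simpa [Complex.sin_pi_div_two] using this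
  have hprod := (hfactor.hasDerivAt.mul hcos).mul
    (HurwitzZeta.differentiable_cosZeta_of_ne_zero ha 1).hasDerivAt
  have hre : ∀ᶠ s : ℂ in 𝓝 1, 0 < s.re :=
    Complex.continuous_re.continuousAt.eventually (lt_mem_nhds (by simp))
  have hsub : HasDerivAt (fun s ↦ HurwitzZeta.hurwitzZetaEven a (1 - s))
      (-(HurwitzZeta.cosZeta a 1 / 2)) 1 := by
    refine (hprod.congr_of_eventuallyEq ?_).congr_deriv ?_
    · filter_upwards [hre] with s hs
      refine HurwitzZeta.hurwitzZetaEven_one_sub a (fun n hn ↦ ?_) (Or.inl ha)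
      rw [hn] at hs
      simp only [Complex.neg_re, Complex.natCast_re] at hs
      linarith [(Nat.cast_nonneg n : (0 : ℝ) ≤ n)]
    · simp [Complex.cos_pi_div_two, Complex.Gamma_one, Complex.cpow_neg]
      field_simp
  have hcomp := HasDerivAt.comp_const_sub (f := fun s ↦ HurwitzZeta.hurwitzZetaEven a (1 - s))
    (1 : ℂ) 0 (by simpa using hsub)
  simpa using hcomp

/-- for `0 < α < 1`, the derivative at `s = 0` of
`s ↦ ζ_H(s, α) + ζ_H(s, 1−α)` equals `log(csc(πα)) − log 2 = −log(2 sin(πα))`. -/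
theorem hurwitz_deriv_zero_add (α : ℝ) (h0 : 0 < α) (h1 : α < 1) :
    deriv (fun s : ℂ =>
        HurwitzZeta.hurwitzZeta (α : UnitAddCircle) s +
          HurwitzZeta.hurwitzZeta ((1 - α : ℝ) : UnitAddCircle) s) 0 =
      -(Real.log (2 * Real.sin (Real.pi * α)) : ℂ) := by
  have ha := unitAddCircle_coe_ne_zero h0 h1
  have hneg : ((1 - α : ℝ) : UnitAddCircle) = -(α : UnitAddCircle) := by
    rw [AddCircle.coe_sub, AddCircle.coe_period, zero_sub]
  have hfun : (fun s : ℂ ↦ HurwitzZeta.hurwitzZeta (α : UnitAddCircle) s +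
      HurwitzZeta.hurwitzZeta ((1 - α : ℝ) : UnitAddCircle) s) =
      fun s ↦ 2 * HurwitzZeta.hurwitzZetaEven (α : UnitAddCircle) s := by
    ext s
    rw [hneg, HurwitzZeta.hurwitzZetaEven_eq]
    ring
  rw [hfun, ((hasDerivAt_hurwitzZetaEven_zero ha).const_mul 2).deriv, cosZeta_one h0 h1]
  ring
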